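/- Properties of the multiclass neural net Jacobian (Lemma 6.2 of the paper). Consider a one-hidden-layer network x ↦ Vφ(Wx) with V ∈ ℝ^{K×k}, W ∈ ℝ^{k×d}, data aggregated as rows of X ∈ ℝ^{n×d}, and multiclass Jacobian J(W) ∈ ℝ^{nK×kd} obtained by stacking the per-output Jacobians J_ℓ(W) = [V_{ℓ,1}diag(φ'(Xw_1))X, …, V_{ℓ,k}diag(φ'(Xw_k))X] for ℓ = 1,…,K. If |φ'(z)| ≤ B for all z, then: (a) ‖J(W)‖ ≤ B√(Kk)·‖V‖_∞·‖X‖; and (b) for any unit vector u ∈ ℝ^{nK}, every row of mat(J(W)ᵀu) ∈ ℝ^{k×d} has Euclidean norm at most B√K·‖V‖_∞·‖X‖. If furthermore φ is twice differentiable with |φ''(z)| ≤ B for all z and all data points have unit Euclidean norm, then for all W̃, W ∈ ℝ^{k×d}, ‖J(W̃) − J(W)‖ ≤ B√K·‖V‖_∞·‖X‖·‖W̃ − W‖_F. -/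

import Mathlib

open Matrix MeasureTheory ProbabilityTheory
open scoped BigOperators ENNReal

/-- Spectral norm (largest singular value) of a real matrix. -/
noncomputable def specNorm {m n : Type*} [Fintype m] [Fintype n] [DecidableEq n]
    (A : Matrix m n ℝ) : ℝ :=
  ‖(Matrix.toEuclideanLin A).toContinuousLinearMap‖

/-- Euclidean norm of a finitely supported real vector given as a plain function. -/
noncomputable def euclNorm {n : Type*} [Fintype n] (v : n → ℝ) : ℝ :=
  Real.sqrt (∑ j, v j ^ 2)

/-- Frobenius norm of a real matrix. -/
noncomputable def frobNorm {m n : Type*} [Fintype m] [Fintype n] (A : Matrix m n ℝ) : ℝ :=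
  Real.sqrt (∑ i, ∑ j, A i j ^ 2)
/-- Largest absolute entry of a finitely indexed family of reals. -/
noncomputable def maxAbs {ι : Type*} [Fintype ι] (f : ι → ℝ) : ℝ :=
  ⨆ i, |f i|

section SpectralNorm

variable {m n : Type*} [Fintype m] [Fintype n] [DecidableEq n]

lemma specNorm_nonneg (A : Matrix m n ℝ) : 0 ≤ specNorm A := norm_nonneg _

open scoped Matrix.Norms.L2Operator in
lemma specNorm_transpose [DecidableEq m] (A : Matrix m n ℝ) : specNorm Aᵀ = specNorm A := by
  have h := Matrix.l2_opNorm_conjTranspose A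
  rwa [Matrix.conjTranspose_eq_transpose_of_trivial] at h

lemma sum_mulVec_sq_le (A : Matrix m n ℝ) (v : n → ℝ) :
    ∑ i, (A *ᵥ v) i ^ 2 ≤ specNorm A ^ 2 * ∑ j, v j ^ 2 := by
  have h := (Matrix.toEuclideanLin A).toContinuousLinearMap.le_opNorm (WithLp.toLp 2 v)
  have h2 := pow_le_pow_left₀ (norm_nonneg _) h 2
  rw [mul_pow, EuclideanSpace.real_norm_sq_eq, EuclideanSpace.real_norm_sq_eq] at h2
  exact h2

lemma specNorm_le_of_sum_mulVec_sq_le (A : Matrix m n ℝ) {c : ℝ} (hc : 0 ≤ c)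
    (h : ∀ v : n → ℝ, ∑ i, (A *ᵥ v) i ^ 2 ≤ c ^ 2 * ∑ j, v j ^ 2) : specNorm A ≤ c := by
  refine ContinuousLinearMap.opNorm_le_bound _ hc fun v => ?_
  refine le_of_pow_le_pow_left₀ two_ne_zero (by positivity) ?_
  rw [mul_pow, EuclideanSpace.real_norm_sq_eq, EuclideanSpace.real_norm_sq_eq]
  exact h v

end SpectralNorm

lemma abs_le_maxAbs {ι : Type*} [Fintype ι] (f : ι → ℝ) (i : ι) : |f i| ≤ maxAbs f :=
  le_ciSup (f := fun i => |f i|) (Set.finite_range _).bddAbove i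

lemma maxAbs_nonneg {ι : Type*} [Fintype ι] (f : ι → ℝ) : 0 ≤ maxAbs f :=
  Real.iSup_nonneg fun _ => abs_nonneg _

section StackedScaling

variable {ι κ σ δ : Type*} [Fintype ι] [Fintype κ] [Fintype δ]
  [DecidableEq ι] [DecidableEq δ]

lemma sum_row_sq_le_of_row_scaling (X : Matrix ι δ ℝ) (A : Matrix (κ × ι) (σ × δ) ℝ)
    (C : κ → σ → ι → ℝ) (hA : ∀ l i s j, A (l, i) (s, j) = C l s i * X i j)
    {s : σ} {b : ℝ} (hC : ∀ l i, |C l s i| ≤ b) (u : κ × ι → ℝ) :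
    ∑ j, (∑ a, A a (s, j) * u a) ^ 2
      ≤ specNorm X ^ 2 * (Fintype.card κ * b ^ 2) * ∑ a, u a ^ 2 := by
  have hrow : ∀ j, ∑ a, A a (s, j) * u a = (Xᵀ *ᵥ fun i => ∑ l, C l s i * u (l, i)) j := by
    intro j
    simp only [Matrix.mulVec, dotProduct, Matrix.transpose_apply, Fintype.sum_prod_type, hA,
      Finset.mul_sum]
    rw [Finset.sum_comm]
    exact Finset.sum_congr rfl fun i _ => Finset.sum_congr rfl fun l _ => by ring
  simp only [hrow]
  refine (sum_mulVec_sq_le _ _).trans ?_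
  rw [specNorm_transpose, mul_assoc]
  refine mul_le_mul_of_nonneg_left ?_ (sq_nonneg _)
  rw [Fintype.sum_prod_type_right, Finset.mul_sum]
  refine Finset.sum_le_sum fun i _ => ?_
  refine (Finset.sum_mul_sq_le_sq_mul_sq _ _ _).trans ?_
  refine mul_le_mul_of_nonneg_right ?_ (Finset.sum_nonneg fun _ _ => sq_nonneg _)
  calc ∑ l, C l s i ^ 2 ≤ ∑ _l : κ, b ^ 2 :=
        Finset.sum_le_sum fun l _ => sq_le_sq' (abs_le.mp (hC l i)).1 (abs_le.mp (hC l i)).2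
    _ = Fintype.card κ * b ^ 2 := by simp

lemma specNorm_le_of_row_scaling [Fintype σ] [DecidableEq κ] [DecidableEq σ]
    (X : Matrix ι δ ℝ) (A : Matrix (κ × ι) (σ × δ) ℝ)
    (C : κ → σ → ι → ℝ) (hA : ∀ l i s j, A (l, i) (s, j) = C l s i * X i j)
    {b : σ → ℝ} (hC : ∀ l s i, |C l s i| ≤ b s) :
    specNorm A ≤ √(Fintype.card κ) * √(∑ s, b s ^ 2) * specNorm X := by
  have hX := specNorm_nonneg X
  rw [← specNorm_transpose]
  refine specNorm_le_of_sum_mulVec_sq_le _ (by positivity) fun u => ?_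
  rw [mul_pow, mul_pow, Real.sq_sqrt (by positivity), Real.sq_sqrt (by positivity),
    Fintype.sum_prod_type]
  calc _ ≤ ∑ s, specNorm X ^ 2 * (Fintype.card κ * b s ^ 2) * ∑ a, u a ^ 2 :=
        Finset.sum_le_sum fun s _ =>
          sum_row_sq_le_of_row_scaling X A C hA (fun l i => hC l s i) u
    _ = _ := by
        rw [← Finset.sum_mul, ← Finset.mul_sum, ← Finset.mul_sum]
        ring

end StackedScaling

/-- **Properties of the multiclass neural net Jacobian** (Lemma 6.2).
For the one-hidden-layer network `x ↦ Vφ(Wx)` with multiclass Jacobian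
`J(W)` stacking `J_ℓ(W) = [V_{ℓ,1}diag(φ'(Xw_1))X, …, V_{ℓ,k}diag(φ'(Xw_k))X]`,
and `|φ'| ≤ B`: (a) `‖J(W)‖ ≤ B√(Kk) ‖V‖_∞ ‖X‖`; (b) for any unit vector `u`,
every row of `mat(J(W)ᵀu)` has Euclidean norm at most `B√K ‖V‖_∞ ‖X‖`; and if
moreover `φ` is twice differentiable with `|φ''| ≤ B` and the data points have unit
norm, then (c) `‖J(W̃) − J(W)‖ ≤ B√K ‖V‖_∞ ‖X‖ ‖W̃ − W‖_F`. -/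
theorem multiclass_jacobian_properties
    {n k d K : ℕ}
    (φ : ℝ → ℝ) (B : ℝ)
    (hφ : Differentiable ℝ φ) (hφ' : ∀ z, |deriv φ z| ≤ B)
    (X : Matrix (Fin n) (Fin d) ℝ)
    (V : Matrix (Fin K) (Fin k) ℝ)
    (J : Matrix (Fin k) (Fin d) ℝ → Matrix (Fin K × Fin n) (Fin k × Fin d) ℝ)
    (hJ : ∀ W ℓ i s j,
      J W (ℓ, i) (s, j) = V ℓ s * deriv φ (∑ j', W s j' * X i j') * X i j) :
    (∀ W, specNorm (J W)
        ≤ B * Real.sqrt (K * k) * maxAbs (fun q : Fin K × Fin k => V q.1 q.2) * specNorm X)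
    ∧ (∀ W, ∀ u : EuclideanSpace ℝ (Fin K × Fin n), ‖u‖ = 1 →
        ∀ s, euclNorm (fun j => ∑ a : Fin K × Fin n, J W a (s, j) * u a)
          ≤ B * Real.sqrt K * maxAbs (fun q : Fin K × Fin k => V q.1 q.2) * specNorm X)
    ∧ (Differentiable ℝ (deriv φ) → (∀ z, |deriv (deriv φ) z| ≤ B) →
        (∀ i, euclNorm (fun j => X i j) = 1) →
        ∀ Wt W : Matrix (Fin k) (Fin d) ℝ,
          specNorm (J Wt - J W)
            ≤ B * Real.sqrt K * maxAbs (fun q : Fin K × Fin k => V q.1 q.2) * specNorm X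
              * frobNorm (Wt - W)) := by
  have hB : 0 ≤ B := (abs_nonneg _).trans (hφ' 0)
  set M := maxAbs (fun q : Fin K × Fin k => V q.1 q.2)
  have hM : 0 ≤ M := maxAbs_nonneg _
  have hV : ∀ ℓ s, |V ℓ s| ≤ M := fun ℓ s =>
    abs_le_maxAbs (fun q : Fin K × Fin k => V q.1 q.2) (ℓ, s)
  have hX := specNorm_nonneg X
  have hC : ∀ W : Matrix (Fin k) (Fin d) ℝ, ∀ ℓ s i,
      |V ℓ s * deriv φ (∑ j', W s j' * X i j')| ≤ M * B := fun W ℓ s i => by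
    rw [abs_mul]
    exact mul_le_mul (hV ℓ s) (hφ' _) (abs_nonneg _) hM
  refine ⟨fun W => ?_, fun W u hu s => ?_, fun hd hφ'' hunit Wt W => ?_⟩
  · refine (specNorm_le_of_row_scaling X (J W) _ (hJ W) (hC W)).trans_eq ?_
    rw [Finset.sum_const, Finset.card_univ, Fintype.card_fin, Fintype.card_fin, nsmul_eq_mul,
      Real.sqrt_mul (Nat.cast_nonneg k), Real.sqrt_sq (by positivity),
      Real.sqrt_mul (Nat.cast_nonneg K)]
    ring
  · have hu' : ∑ a, u a ^ 2 = 1 := by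
      rw [← EuclideanSpace.real_norm_sq_eq, hu, one_pow]
    refine Real.sqrt_le_iff.mpr ⟨by positivity, ?_⟩
    refine (sum_row_sq_le_of_row_scaling X (J W) _ (hJ W)
      (fun ℓ i => hC W ℓ s i) u).trans_eq ?_
    rw [hu', Fintype.card_fin, mul_pow _ (specNorm X), mul_pow _ M, mul_pow B,
      Real.sq_sqrt (Nat.cast_nonneg K)]
    ring
  · have hlip : ∀ x y, |deriv φ x - deriv φ y| ≤ B * |x - y| := fun x y =>
      convex_univ.norm_image_sub_le_of_norm_deriv_le (fun z _ => hd z) (fun z _ => hφ'' z)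
        (Set.mem_univ y) (Set.mem_univ x)
    have hinner : ∀ s i, |∑ j, Wt s j * X i j - ∑ j, W s j * X i j|
        ≤ √(∑ j, (Wt - W) s j ^ 2) := fun s i => by
      have hi : ∑ j, X i j ^ 2 = 1 := Real.sqrt_eq_one.mp (hunit i)
      refine Real.abs_le_sqrt ?_
      rw [← Finset.sum_sub_distrib]
      simp only [← sub_mul]
      refine (Finset.sum_mul_sq_le_sq_mul_sq _ _ _).trans_eq ?_
      rw [hi, mul_one]
      rfl
    have hA : ∀ ℓ i s j, (J Wt - J W) (ℓ, i) (s, j) =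
        (V ℓ s * (deriv φ (∑ j', Wt s j' * X i j') - deriv φ (∑ j', W s j' * X i j'))) * X i j :=
      fun ℓ i s j => by
        rw [Matrix.sub_apply, hJ, hJ]
        ring
    refine (specNorm_le_of_row_scaling X _ _ hA
      (b := fun s => M * B * √(∑ j, (Wt - W) s j ^ 2)) fun ℓ s i => ?_).trans_eq ?_
    · rw [abs_mul, mul_assoc]
      exact mul_le_mul (hV ℓ s)
        ((hlip _ _).trans (mul_le_mul_of_nonneg_left (hinner s i) hB)) (abs_nonneg _) hM
    · have hsq : ∀ s, (M * B * √(∑ j, (Wt - W) s j ^ 2)) ^ 2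
          = (M * B) ^ 2 * ∑ j, (Wt - W) s j ^ 2 := fun s => by
        rw [mul_pow, Real.sq_sqrt (Finset.sum_nonneg fun _ _ => sq_nonneg _)]
      simp only [hsq]
      rw [← Finset.mul_sum, Real.sqrt_mul (sq_nonneg _), Real.sqrt_sq (by positivity),
        Fintype.card_fin, frobNorm]
      ring
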